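/- Let m < n be positive integers, let B be an m × n real matrix such that b_{ij} = δ_{ij} for 1 ≤ i, j ≤ m, and let b be a non-negative vector in ℝ^m such that the set {α ∈ ℝ₊ⁿ : Bα = b} is bounded and such that (B, b) is non-degenerate. Let S ⊆ [n] be a set of size m with 1 ∉ S that is not a feasible basis of (B, b). Then the number of feasible bases F of (B, b) with 1 ∈ F and F \ S = {1} is either 0 or 2. -/

import Mathlib

/-- `J ⊆ [n]` of size `m` is a *feasible basis* of `(B, b)` if the columns `B_j`, `j ∈ J`,
are linearly independent and `b = ∑_{j ∈ J} α_j B_j` for some non-negative `α_j`. -/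
def FeasibleBasis {m n : ℕ} (B : Matrix (Fin m) (Fin n) ℝ) (b : Fin m → ℝ)
    (J : Finset (Fin n)) : Prop :=
  J.card = m ∧
  LinearIndependent ℝ (fun j : J => (fun i => B i (j : Fin n))) ∧
  ∃ α : Fin n → ℝ, (∀ j, 0 ≤ α j) ∧ (∀ j ∉ J, α j = 0) ∧ B.mulVec α = b

/-- `(B, b)` is *non-degenerate* if `b` is not in the cone spanned by fewer than `m`
columns of `B`. -/
def NonDegenerate {m n : ℕ} (B : Matrix (Fin m) (Fin n) ℝ) (b : Fin m → ℝ) : Prop :=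
  ¬ ∃ J : Finset (Fin n), J.card < m ∧
      ∃ α : Fin n → ℝ, (∀ j, 0 ≤ α j) ∧ (∀ j ∉ J, α j = 0) ∧ B.mulVec α = b

/-- `J ⊆ [n]` is *subordinating* for `C` if every column `k` of `C` is `J`-subordinated,
i.e. for some row `i` we have `c_{ik} ≤ c_{ij}` for every `j ∈ J`. -/
def Subordinating {m n : ℕ} (C : Matrix (Fin m) (Fin n) ℝ) (J : Finset (Fin n)) : Prop :=
  ∀ k : Fin n, ∃ i : Fin m, ∀ j ∈ J, C i k ≤ C i j

/-- `C` is *ordinal-generic* if all the elements in each row of `C` are distinct. -/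
def OrdinalGeneric {m n : ℕ} (C : Matrix (Fin m) (Fin n) ℝ) : Prop :=
  ∀ i : Fin m, Function.Injective (C i)

/-- Linear independence of the columns indexed by `J`, in terms of vectors supported on `J`. -/
theorem linearIndependent_columns_iff {m n : ℕ} (B : Matrix (Fin m) (Fin n) ℝ)
    (J : Finset (Fin n)) :
    LinearIndependent ℝ (fun j : J => (fun i => B i (j : Fin n))) ↔
      ∀ β : Fin n → ℝ, (∀ j ∉ J, β j = 0) → B.mulVec β = 0 → β = 0 := by
  have key : ∀ β : Fin n → ℝ, (∀ j ∉ J, β j = 0) →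
      ∑ j : J, β j • (fun i => B i (j : Fin n)) = B.mulVec β := by
    intro β hβ
    rw [Finset.sum_coe_sort J (fun j => β j • (fun i => B i j))]
    ext i
    simp only [Finset.sum_apply, Pi.smul_apply, smul_eq_mul, Matrix.mulVec, dotProduct]
    rw [Finset.sum_subset (Finset.subset_univ J)]
    · exact Finset.sum_congr rfl fun j _ => mul_comm _ _
    · intro j _ hj
      simp [hβ j hj]
  rw [Fintype.linearIndependent_iff]
  constructor
  · intro h β hβ hB
    have h0 := h (fun j => β j) ((key β hβ).trans hB)
    ext j
    by_cases hj : j ∈ J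
    · exact h0 ⟨j, hj⟩
    · exact hβ j hj
  · intro h g hg j
    let β : Fin n → ℝ := fun k => if hk : k ∈ J then g ⟨k, hk⟩ else 0
    have hβ : ∀ k ∉ J, β k = 0 := fun k hk => by simp [β, hk]
    have hβg : ∀ k : J, β k = g k := fun k => by simp [β]
    have h0 := h β hβ (by
      rw [← key β hβ]
      simpa only [hβg] using hg)
    rw [← hβg j, h0]
    rfl

/-- Any `m + 1` columns of a matrix with `m` rows satisfy a nontrivial linear relation. -/
theorem exists_relation_of_card_eq {m n : ℕ} (B : Matrix (Fin m) (Fin n) ℝ)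
    (T : Finset (Fin n)) (hT : T.card = m + 1) :
    ∃ d : Fin n → ℝ, (∀ j ∉ T, d j = 0) ∧ B.mulVec d = 0 ∧ d ≠ 0 := by
  have h : ¬ LinearIndependent ℝ (fun j : T => (fun i => B i (j : Fin n))) := by
    intro h
    have := h.fintype_card_le_finrank
    simp [hT] at this
  rw [linearIndependent_columns_iff] at h
  push Not at h
  exact h

/-- In a non-degenerate system, a feasible point supported on `m + 1` columns vanishes on at most
one of them. -/
theorem NonDegenerate.eq_of_apply_eq_zero {m n : ℕ} {B : Matrix (Fin m) (Fin n) ℝ}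
    {b : Fin m → ℝ} (hnd : NonDegenerate B b) {T : Finset (Fin n)} (hT : T.card = m + 1)
    {α : Fin n → ℝ} (h0 : ∀ j, 0 ≤ α j) (hα : ∀ j ∉ T, α j = 0) (hb : B.mulVec α = b)
    {v w : Fin n} (hv : v ∈ T) (hw : w ∈ T) (hαv : α v = 0) (hαw : α w = 0) : v = w := by
  by_contra hne
  have hw' : w ∈ T.erase v := Finset.mem_erase.2 ⟨Ne.symm hne, hw⟩
  have h1 := Finset.card_erase_add_one hv
  have h2 := Finset.card_erase_add_one hw'
  refine hnd ⟨(T.erase v).erase w, by omega, α, h0, fun j hj => ?_, hb⟩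
  by_cases hjw : j = w
  · rw [hjw, hαw]
  by_cases hjv : j = v
  · rw [hjv, hαv]
  · exact hα j fun hjT => hj (by simp [hjw, hjv, hjT])

/-- The pivot step: among `m + 1` columns containing a feasible basis, exactly two columns can be
removed so as to leave a feasible basis. -/
theorem FeasibleBasis.exists_unique_pivot {m n : ℕ} {B : Matrix (Fin m) (Fin n) ℝ}
    {b : Fin m → ℝ}
    (hbdd : Bornology.IsBounded {α : Fin n → ℝ | (∀ j, 0 ≤ α j) ∧ B.mulVec α = b})
    (hnd : NonDegenerate B b) {T : Finset (Fin n)} (hT : T.card = m + 1)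
    {v : Fin n} (hv : v ∈ T) (hF : FeasibleBasis B b (T.erase v)) :
    ∃ u ∈ T, u ≠ v ∧ ∀ w ∈ T, FeasibleBasis B b (T.erase w) ↔ w = v ∨ w = u := by
  have erase_zero : ∀ {β : Fin n → ℝ} {w : Fin n}, (∀ j ∉ T, β j = 0) → β w = 0 →
      ∀ j ∉ T.erase w, β j = 0 := by
    intro β w hβ hw j hj
    by_cases hjw : j = w
    · rw [hjw, hw]
    · exact hβ j fun h => hj (Finset.mem_erase.2 ⟨hjw, h⟩)
  have hF' := hF
  obtain ⟨-, hli, α, h0, hα, hαb⟩ := hF'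
  rw [linearIndependent_columns_iff] at hli
  have hαv : α v = 0 := hα v (by simp)
  have hαT : ∀ j ∉ T, α j = 0 := fun j hj => hα j fun h => hj (Finset.mem_of_mem_erase h)
  have hαpos : ∀ j ∈ T, j ≠ v → 0 < α j := fun j hj hjv =>
    (h0 j).lt_of_ne fun h => hjv (hnd.eq_of_apply_eq_zero hT h0 hαT hαb hj hv h.symm hαv)
  obtain ⟨d, hdT, hBd, hdv⟩ :
      ∃ d : Fin n → ℝ, (∀ j ∉ T, d j = 0) ∧ B.mulVec d = 0 ∧ d v = 1 := by
    obtain ⟨d, hdT, hBd, hd⟩ := exists_relation_of_card_eq B T hT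
    have hdv : d v ≠ 0 := fun h => hd (hli d (erase_zero hdT h) hBd)
    refine ⟨(d v)⁻¹ • d, fun j hj => by simp [hdT j hj], ?_, by simp [hdv]⟩
    rw [Matrix.mulVec_smul, hBd, smul_zero]
  have hline : ∀ β : Fin n → ℝ, (∀ j ∉ T, β j = 0) → B.mulVec β = 0 → β = β v • d := by
    intro β hβ hBβ
    refine sub_eq_zero.1 (hli (β - β v • d) (erase_zero ?_ ?_) ?_)
    · intro j hj
      simp [hβ j hj, hdT j hj]
    · simp [hdv]
    · rw [Matrix.mulVec_sub, Matrix.mulVec_smul, hBβ, hBd, smul_zero, sub_zero]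
  have hmove : ∀ t : ℝ, B.mulVec (α + t • d) = b := fun t => by
    rw [Matrix.mulVec_add, Matrix.mulVec_smul, hBd, smul_zero, add_zero, hαb]
  have hneg : ∃ j, d j < 0 := by
    by_contra! hd
    obtain ⟨C, hC⟩ := hbdd.exists_norm_le
    have hmem : α + (|C| + 1) • d ∈ {α : Fin n → ℝ | (∀ j, 0 ≤ α j) ∧ B.mulVec α = b} :=
      ⟨fun j => add_nonneg (h0 j) (mul_nonneg (by positivity) (hd j)), hmove _⟩
    have h1 := (norm_le_pi_norm _ v).trans (hC _ hmem)
    simp only [Pi.add_apply, Pi.smul_apply, hαv, hdv, smul_eq_mul, mul_one, zero_add,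
      Real.norm_eq_abs] at h1
    have h2 := le_abs_self (|C| + 1)
    have h3 := le_abs_self C
    linarith
  obtain ⟨u, hu, hmin⟩ := Finset.exists_min_image (Finset.univ.filter fun j => d j < 0)
    (fun j => α j / (-d j)) (by simpa [Finset.filter_nonempty_iff] using hneg)
  simp only [Finset.mem_filter, Finset.mem_univ, true_and] at hu hmin
  have huT : u ∈ T := by
    by_contra h
    exact hu.ne (hdT u h)
  have huv : u ≠ v := by
    rintro rfl
    linarith
  set t := α u / (-d u) with ht
  have htpos : 0 < t := div_pos (hαpos u huT huv) (neg_pos.2 hu)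
  have htu : α u + t * d u = 0 := by
    rw [ht]
    field_simp [hu.ne]
    ring
  have hnonneg : ∀ j, 0 ≤ α j + t * d j := by
    intro j
    rcases lt_or_ge (d j) 0 with hj | hj
    · have h1 := (le_div_iff₀ (neg_pos.2 hj)).1 (hmin j hj)
      linarith
    · exact add_nonneg (h0 j) (mul_nonneg htpos.le hj)
  refine ⟨u, huT, huv, fun w hw => ⟨?_, ?_⟩⟩
  · rintro ⟨-, -, γ, hγ0, hγ, hγb⟩
    have hγw : γ w = 0 := hγ w (by simp)
    have hγT : ∀ j ∉ T, γ j = 0 := fun j hj => hγ j fun h => hj (Finset.mem_of_mem_erase h)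
    have hdiff := hline (γ - α) (fun j hj => by simp [hγT j hj, hαT j hj])
      (by rw [Matrix.mulVec_sub, hγb, hαb, sub_self])
    have hγeq : ∀ j, γ j = α j + γ v * d j := by
      intro j
      have := congrFun hdiff j
      simp only [Pi.sub_apply, Pi.smul_apply, smul_eq_mul, hαv, sub_zero] at this
      linarith
    by_contra! hne
    have hpos := hαpos w hw hne.1
    have hγv : 0 < γ v := (hγ0 v).lt_of_ne fun h =>
      hne.1 (hnd.eq_of_apply_eq_zero hT hγ0 hγT hγb hw hv hγw h.symm)
    have hγu : 0 < γ u := (hγ0 u).lt_of_ne fun h =>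
      hne.2 (hnd.eq_of_apply_eq_zero hT hγ0 hγT hγb hw huT hγw h.symm)
    have hlt : γ v < t := by
      rw [hγeq u] at hγu
      nlinarith
    have hw0 := hγeq w
    have hdw : d w < 0 := by
      by_contra! h
      nlinarith [mul_nonneg hγv.le h]
    nlinarith [hnonneg w]
  · rintro (rfl | rfl)
    · exact hF
    · refine ⟨by rw [Finset.card_erase_of_mem hw, hT, Nat.add_sub_cancel], ?_, α + t • d,
        hnonneg, erase_zero (fun j hj => by simp [hαT j hj, hdT j hj]) htu, hmove t⟩
      rw [linearIndependent_columns_iff]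
      intro β hβ hBβ
      have hβd := hline β (fun j hj => hβ j fun h => hj (Finset.mem_of_mem_erase h)) hBβ
      have hβw : β w = 0 := hβ w (by simp)
      have h1 := congrFun hβd w
      simp only [hβw, Pi.smul_apply, smul_eq_mul] at h1
      rw [hβd, (mul_eq_zero.1 h1.symm).resolve_right hu.ne, zero_smul]

/-- **Degree claim for subordinating-side vertices that are not feasible bases.**  Let
`(B, b)` be non-degenerate with identity leading block, `b ≥ 0` and bounded feasible
region.  Let `S ⊆ [n]` with `|S| = m` and `1 ∉ S` be not a feasible basis of `(B, b)`.
Then the number of feasible bases `F` of `(B, b)` with `1 ∈ F` and `F \ S = {1}` is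
either `0` or `2`. -/
theorem subordinating_side_degree {m n : ℕ} (hm : 0 < m) (hmn : m < n)
    (B : Matrix (Fin m) (Fin n) ℝ) (b : Fin m → ℝ)
    (hB : ∀ i j : Fin m, B i (Fin.castLE hmn.le j) = if i = j then 1 else 0)
    (hb : ∀ i, 0 ≤ b i)
    (hbdd : Bornology.IsBounded {α : Fin n → ℝ | (∀ j, 0 ≤ α j) ∧ B.mulVec α = b})
    (hnd : NonDegenerate B b)
    (S : Finset (Fin n)) (hScard : S.card = m)
    (h1S : (⟨0, by omega⟩ : Fin n) ∉ S)
    (hSnf : ¬ FeasibleBasis B b S) :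
    {F : Finset (Fin n) | FeasibleBasis B b F ∧ (⟨0, by omega⟩ : Fin n) ∈ F ∧
        F \ S = {(⟨0, by omega⟩ : Fin n)}}.ncard = 0 ∨
    {F : Finset (Fin n) | FeasibleBasis B b F ∧ (⟨0, by omega⟩ : Fin n) ∈ F ∧
        F \ S = {(⟨0, by omega⟩ : Fin n)}}.ncard = 2 := by
  generalize (⟨0, by omega⟩ : Fin n) = e at *
  have hT : (insert e S).card = m + 1 := by rw [Finset.card_insert_of_notMem h1S, hScard]
  have hset : {F : Finset (Fin n) | FeasibleBasis B b F ∧ e ∈ F ∧ F \ S = {e}} =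
      (insert e S).erase '' {w | w ∈ S ∧ FeasibleBasis B b ((insert e S).erase w)} := by
    ext F
    simp only [Set.mem_ofPred_eq, Set.mem_image]
    constructor
    · rintro ⟨hF, -, hFS⟩
      have hsub : F ⊆ insert e S := by
        rw [Finset.insert_eq, ← hFS]
        intro x hx
        by_cases hxS : x ∈ S <;> simp [hx, hxS]
      have hcard : (insert e S \ F).card = 1 := by
        rw [Finset.card_sdiff_of_subset hsub, hT, hF.1, Nat.add_sub_cancel_left]
      obtain ⟨w, hw⟩ := Finset.card_eq_one.1 hcard
      have hFw : (insert e S).erase w = F := by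
        rw [← Finset.sdiff_singleton_eq_erase, ← hw, Finset.sdiff_sdiff_eq_self hsub]
      have hwm : w ∈ insert e S \ F := by simp [hw]
      have heF : e ∈ F \ S := by simp [hFS]
      rw [Finset.mem_sdiff] at hwm heF
      refine ⟨w, ⟨(Finset.mem_insert.1 hwm.1).resolve_left ?_, hFw.symm ▸ hF⟩, hFw⟩
      rintro rfl
      exact hwm.2 heF.1
    · rintro ⟨w, ⟨hw, hF⟩, rfl⟩
      have hew : e ≠ w := fun h => h1S (h ▸ hw)
      refine ⟨hF, by simp [hew], ?_⟩
      ext x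
      simp only [Finset.mem_sdiff, Finset.mem_erase, Finset.mem_insert, Finset.mem_singleton]
      constructor
      · rintro ⟨⟨-, hx | hx⟩, hxS⟩
        · exact hx
        · exact absurd hx hxS
      · rintro rfl
        exact ⟨⟨hew, Or.inl rfl⟩, h1S⟩
  have hinj : Set.InjOn (insert e S).erase
      {w | w ∈ S ∧ FeasibleBasis B b ((insert e S).erase w)} :=
    (Finset.erase_injOn (insert e S)).mono fun w hw => Finset.mem_insert_of_mem hw.1
  rw [hset, hinj.ncard_image]
  rcases Set.eq_empty_or_nonempty
    {w | w ∈ S ∧ FeasibleBasis B b ((insert e S).erase w)} with h | ⟨v, hvS, hv⟩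
  · left
    rw [h, Set.ncard_empty]
  · right
    obtain ⟨u, hu, huv, hiff⟩ :=
      hv.exists_unique_pivot hbdd hnd hT (Finset.mem_insert_of_mem hvS)
    have hue : u ≠ e := by
      rintro rfl
      have := (hiff u hu).2 (Or.inr rfl)
      rw [Finset.erase_insert h1S] at this
      exact hSnf this
    have huS : u ∈ S := (Finset.mem_insert.1 hu).resolve_left hue
    rw [← Set.ncard_pair huv.symm]
    congr 1
    ext w
    simp only [Set.mem_ofPred_eq, Set.mem_insert_iff, Set.mem_singleton_iff]
    constructor
    · rintro ⟨hw, hwF⟩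
      exact (hiff w (Finset.mem_insert_of_mem hw)).1 hwF
    · intro h
      have hw : w ∈ S := by rcases h with rfl | rfl <;> assumption
      exact ⟨hw, (hiff w (Finset.mem_insert_of_mem hw)).2 h⟩
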